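/- Let T be a minimal m-interval exchange transformation defined by a separating permutation. If there exist an interval exchange transformation S and an integer n ≥ 2 with S^n = T, then rank(T) ≤ 1 + ⌊m/2⌋. -/

import Mathlib

open Set

namespace IETRoots

noncomputable section

/-- The unit interval `[0,1)`, the domain of our interval exchange transformations. -/
def unitI : Set ℝ := Set.Ico 0 1

/-- `T : ℝ → ℝ` is (the extension by the identity of) an interval exchange
transformation: it fixes the complement of `[0,1)`, maps `[0,1)` bijectively onto
itself, and there is a finite partition of `[0,1)` into half-open intervals on each
of which `T` is a translation.  The group `𝔾` of IETs is the set of such maps under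
composition. -/
def IsIET (T : ℝ → ℝ) : Prop :=
  Set.BijOn T unitI unitI ∧ (∀ x, x ∉ unitI → T x = x) ∧
  ∃ (k : ℕ) (β : Fin (k + 1) → ℝ), StrictMono β ∧ β 0 = 0 ∧ β (Fin.last k) = 1 ∧
    ∀ i : Fin k, ∃ c : ℝ, ∀ x ∈ Set.Ico (β i.castSucc) (β i.succ), T x = x + c

/-- The `ℤ`-orbit `{T^n x : n ∈ ℤ}` of `x` under the bijection `T`. -/
def orbitZ (T : ℝ → ℝ) (x : ℝ) : Set ℝ := {y | ∃ n : ℕ, T^[n] x = y ∨ T^[n] y = x}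

/-- `T` is minimal: every orbit is dense in `[0,1)`. -/
def IsMinimal (T : ℝ → ℝ) : Prop := ∀ x ∈ unitI, unitI ⊆ closure (orbitZ T x)

/-- `T` is of rotation type: `T x = x + α (mod 1)` on `[0,1)`. -/
def IsRotationType (T : ℝ → ℝ) : Prop := ∃ α : ℝ, ∀ x ∈ unitI, T x = Int.fract (x + α)

/-- `T` has an `n`-th root in the group `𝔾` of IETs for some `n ≥ 2`. -/
def HasNontrivialRoot (T : ℝ → ℝ) : Prop :=
  ∃ (S : ℝ → ℝ) (n : ℕ), IsIET S ∧ 2 ≤ n ∧ S^[n] = T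

/-- The set `D(T)` of points of `[0,1)` at which `T` is discontinuous
(as a map of `[0,1)`). -/
def DiscSet (T : ℝ → ℝ) : Set ℝ := {x | x ∈ unitI ∧ ¬ ContinuousWithinAt T unitI x}

/-- `β_j = λ_1 + ⋯ + λ_j` (`0`-indexed: the sum of the first `j` lengths). -/
def betaPt {m : ℕ} (lam : Fin m → ℝ) (j : ℕ) : ℝ :=
  ∑ i ∈ Finset.univ.filter (fun i : Fin m => (i : ℕ) < j), lam i

/-- The interval exchange transformation `T_{(π,λ)}` determined by a permutation
`π ∈ S_m` and a length vector `λ`: on `I_j = [β_{j-1}, β_j)` it is given by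
`x ↦ x - ∑_{i<j} λ_i + ∑_{π(i)<π(j)} λ_i`; outside `[0,1)` it is the identity. -/
noncomputable def ietMap {m : ℕ} (π : Equiv.Perm (Fin m)) (lam : Fin m → ℝ) : ℝ → ℝ :=
  fun x =>
    if h : ∃ j : Fin m, x ∈ Set.Ico (betaPt lam (j : ℕ)) (betaPt lam (j : ℕ) + lam j) then
      x - betaPt lam (h.choose : ℕ) +
        ∑ i ∈ Finset.univ.filter (fun i : Fin m => π i < π h.choose), lam i
    else x

/-- A permutation `π ∈ S_m` is separating if `π(i+1) ≠ π(i) + 1` for `1 ≤ i ≤ m-1`. -/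
def Separating {m : ℕ} (π : Equiv.Perm (Fin m)) : Prop :=
  ∀ i j : Fin m, (j : ℕ) = (i : ℕ) + 1 → (π j : ℕ) ≠ (π i : ℕ) + 1

/-- A permutation `π ∈ S_m` is irreducible if `π({1,…,k}) ≠ {1,…,k}` for all `k < m`. -/
def IrreduciblePerm {m : ℕ} (π : Equiv.Perm (Fin m)) : Prop :=
  ∀ k : ℕ, 1 ≤ k → k < m → ∃ i : Fin m, (i : ℕ) < k ∧ k ≤ (π i : ℕ)

/-- The endpoints `0 = γ_0 < γ_1 < ⋯ < γ_{m-1} < γ_m = 1`, namely the discontinuities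
of `T` together with `0` and `1`. -/
def endpointsOf (T : ℝ → ℝ) : Set ℝ := insert 0 (insert 1 (DiscSet T))

/-- The set of lengths `l_j = γ_j - γ_{j-1}` of the intervals of continuity of `T`,
i.e. the gaps between consecutive endpoints. -/
def gapLengths (T : ℝ → ℝ) : Set ℝ :=
  {l | ∃ a ∈ endpointsOf T, ∃ b ∈ endpointsOf T,
        a < b ∧ (∀ c ∈ endpointsOf T, ¬(a < c ∧ c < b)) ∧ l = b - a}

/-- The rank of `T`: the dimension of the `ℚ`-vector space spanned by the lengths
`l_1, …, l_m`. -/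
noncomputable def ietRank (T : ℝ → ℝ) : ℕ :=
  Module.finrank ℚ (Submodule.span ℚ (gapLengths T))

/-- Keane's infinite distinct orbit condition for an `m`-IET `T = T_{(π,λ)}`:
the orbits of `β_1, …, β_{m-1}` are infinite and pairwise disjoint. -/
def SatisfiesIDOC {m : ℕ} (lam : Fin m → ℝ) (T : ℝ → ℝ) : Prop :=
  (∀ j : ℕ, 1 ≤ j → j ≤ m - 1 → (orbitZ T (betaPt lam j)).Infinite) ∧
  ∀ j j' : ℕ, 1 ≤ j → j ≤ m - 1 → 1 ≤ j' → j' ≤ m - 1 → j ≠ j' →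
    orbitZ T (betaPt lam j) ∩ orbitZ T (betaPt lam j') = ∅

/-- A rotation: a `2`-IET with permutation `(21)`, i.e. `x ↦ x + α (mod 1)`
with `α ∈ (0,1)`. -/
def IsRotation (S : ℝ → ℝ) : Prop :=
  (∀ x, x ∉ unitI → S x = x) ∧ ∃ α ∈ Set.Ioo (0 : ℝ) 1, ∀ x ∈ unitI, S x = Int.fract (x + α)

/-- Conjugacy in the group `𝔾` of IETs. -/
def IsConjugate (T T' : ℝ → ℝ) : Prop := ∃ g : ℝ → ℝ, IsIET g ∧ g ∘ T = T' ∘ g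

/-- `T` is a tower of type `(n_1, …, n_k)` over the `k`-IET `S`:  there is a partition
`0 = t_0 < t_1 < ⋯ < t_k = 1` into intervals `I_i` on which `S` is a translation, a
scaling factor `c > 0`, and for each `i` a family of `n_i` pairwise disjoint "levels"
(scaled copies of `I_i`) which together partition `[0,1)`, such that `T` translates each
level of the `i`-th column onto the next one, and maps the top level back to the bottom
levels according to `S` (all after rescaling by `c`). -/
def IsTowerOver {k : ℕ} (T : ℝ → ℝ) (n : Fin k → ℕ) (S : ℝ → ℝ) : Prop :=
  IsIET T ∧ IsIET S ∧ (∀ i, 0 < n i) ∧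
  ∃ (t : Fin (k + 1) → ℝ) (c : ℝ) (a : Fin k → ℕ → ℝ),
    StrictMono t ∧ t 0 = 0 ∧ t (Fin.last k) = 1 ∧ 0 < c ∧
    (∀ i : Fin k, ∃ d : ℝ, ∀ x ∈ Set.Ico (t i.castSucc) (t i.succ), S x = x + d) ∧
    (∀ i : Fin k, ∀ j : ℕ, j < n i →
      Set.Ico (a i j) (a i j + c * (t i.succ - t i.castSucc)) ⊆ unitI) ∧
    (∀ i i' : Fin k, ∀ j j' : ℕ, j < n i → j' < n i' → (i, j) ≠ (i', j') →
      Disjoint (Set.Ico (a i j) (a i j + c * (t i.succ - t i.castSucc)))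
        (Set.Ico (a i' j') (a i' j' + c * (t i'.succ - t i'.castSucc)))) ∧
    (∀ y ∈ unitI, ∃ (i : Fin k) (j : ℕ), j < n i ∧
      y ∈ Set.Ico (a i j) (a i j + c * (t i.succ - t i.castSucc))) ∧
    (∀ i : Fin k, ∀ j : ℕ, j + 1 < n i → ∀ x ∈ Set.Ico (t i.castSucc) (t i.succ),
      T (a i j + c * (x - t i.castSucc)) = a i (j + 1) + c * (x - t i.castSucc)) ∧
    (∀ i : Fin k, ∀ x ∈ Set.Ico (t i.castSucc) (t i.succ), ∀ i' : Fin k,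
      S x ∈ Set.Ico (t i'.castSucc) (t i'.succ) →
      T (a i (n i - 1) + c * (x - t i.castSucc)) = a i' 0 + c * (S x - t i'.castSucc))

/-- The data of the first return map of `T` to `J = [a,b)`: a partition
`a = s_0 < s_1 < ⋯ < s_k = b` of `J`, return times `mt_i ≥ 1` and translation
constants `c_i` such that for `x` in the `i`-th piece the iterates `T^j x`, `0 < j < mt_i`,
avoid `J`, while `T^{mt_i} x = x + c_i ∈ J`.  Thus the first return map `T_J` is the
`k`-IET `x ↦ x + c_i` on the `i`-th piece. -/
def IsFirstReturnSystem (T : ℝ → ℝ) (a b : ℝ) {k : ℕ} (s : Fin (k + 1) → ℝ)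
    (mt : Fin k → ℕ) (c : Fin k → ℝ) : Prop :=
  StrictMono s ∧ s 0 = a ∧ s (Fin.last k) = b ∧
  ∀ i : Fin k, 0 < mt i ∧ ∀ x ∈ Set.Ico (s i.castSucc) (s i.succ),
    (∀ j : ℕ, 0 < j → j < mt i → T^[j] x ∉ Set.Ico a b) ∧
    T^[mt i] x ∈ Set.Ico a b ∧ T^[mt i] x = x + c i

/-- A finite sequence `x_0, …, x_k` is an `S`-chain if `x_0` and `x_k` lie in
`D(S) ∪ {0}` and `S x_i = x_{i+1}`. -/
def IsSChainSeq (S : ℝ → ℝ) {k : ℕ} (x : Fin (k + 1) → ℝ) : Prop :=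
  x 0 ∈ insert (0 : ℝ) (DiscSet S) ∧ x (Fin.last k) ∈ insert (0 : ℝ) (DiscSet S) ∧
  ∀ i : Fin k, S (x i.castSucc) = x i.succ

/-- A set `C ⊆ ℝ` is (the underlying set of) an `S`-chain. -/
def IsSChain (S : ℝ → ℝ) (C : Set ℝ) : Prop :=
  ∃ (k : ℕ) (x : Fin (k + 1) → ℝ), IsSChainSeq S x ∧ C = Set.range x

/-- A maximal `S`-chain: an `S`-chain which is not a proper subset of another `S`-chain. -/
def IsMaximalSChain (S : ℝ → ℝ) (C : Set ℝ) : Prop :=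
  IsSChain S C ∧ ∀ C', IsSChain S C' → C ⊆ C' → C = C'

/-- The open simplex `Δ_m ⊆ ℝ^m`. -/
def simplexSet (m : ℕ) : Set (Fin m → ℝ) := {lam | (∀ i, 0 < lam i) ∧ ∑ i, lam i = 1}

/-- The affine chart identifying (a superset of) `Δ_m` with a subset of `ℝ^{m-1}`:
`λ_i = x_i` for `i < m-1` and `λ_{m-1} = 1 - ∑ x_j`.  Lebesgue measure on `Δ_m`
is the `(m-1)`-dimensional Lebesgue measure carried through this chart. -/
def chartMap (m : ℕ) (x : Fin (m - 1) → ℝ) : Fin m → ℝ := fun i =>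
  if h : (i : ℕ) < m - 1 then x ⟨(i : ℕ), h⟩ else 1 - ∑ j, x j

/-- The permutation `(321) ∈ S_3`, sending `1 ↦ 3`, `2 ↦ 2`, `3 ↦ 1`. -/
def perm321 : Equiv.Perm (Fin 3) :=
  ⟨fun i => i.rev, fun i => i.rev, fun i => Fin.rev_rev i, fun i => Fin.rev_rev i⟩

end


open Filter Topology MeasureTheory

/-- `F` is a translation on a left neighbourhood of `x`, up to and including `x`. -/
def LC (F : ℝ → ℝ) (x : ℝ) : Prop := ∀ᶠ δ in 𝓝[>] (0 : ℝ), F (x - δ) = F x - δ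

/-- `F` is a translation on a right neighbourhood of `x`. -/
def RC (F : ℝ → ℝ) (x : ℝ) : Prop := ∀ᶠ δ in 𝓝[>] (0 : ℝ), F (x + δ) = F x + δ

/-- Points of `(0,1)` where `F` is not a translation from the left. -/
def LD (F : ℝ → ℝ) : Set ℝ := {x | x ∈ Ioo (0 : ℝ) 1 ∧ ¬ LC F x}

lemma ev_iff {p : ℝ → Prop} :
    (∀ᶠ δ in 𝓝[>] (0 : ℝ), p δ) ↔ ∃ ε > 0, ∀ δ, 0 < δ → δ < ε → p δ := by
  constructor
  · intro h
    obtain ⟨u, hu, h⟩ := mem_nhdsGT_iff_exists_Ioo_subset.1 h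
    exact ⟨u, hu, fun δ h1 h2 => h ⟨h1, h2⟩⟩
  · rintro ⟨ε, he, h⟩
    exact mem_nhdsGT_iff_exists_Ioo_subset.2 ⟨ε, he, fun δ hδ => h δ hδ.1 hδ.2⟩

lemma LC.comp {F G : ℝ → ℝ} {x : ℝ} (h1 : LC F x) (h2 : LC G (F x)) :
    LC (fun y => G (F y)) x := by
  unfold LC at *
  filter_upwards [h1, h2] with δ a b
  rw [a, b]

lemma translation_on {F : ℝ → ℝ} {u v : ℝ} (hR : ∀ x ∈ Ico u v, RC F x)
    (hL : ∀ x ∈ Ioo u v, LC F x) : ∀ x ∈ Ico u v, F x = F u + (x - u) := by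
  intro w hw
  have key := constant_of_has_deriv_right_zero (f := fun y => F y - y) (a := u) (b := w) ?_ ?_
    w ⟨hw.1, le_rfl⟩
  · linarith
  · intro x hx
    have hxR := hR x ⟨hx.1, hx.2.trans_lt hw.2⟩
    obtain ⟨ε, he, h⟩ := ev_iff.1 hxR
    rcases hx.1.eq_or_lt with h0 | h0
    · have : ∀ y ∈ Icc u w, y < x + ε → F y - y = F x - x := by
        intro y hy hy2
        rcases (h0 ▸ hy.1 : x ≤ y).eq_or_lt with h3 | h3
        · rw [h3]
        · have := h (y - x) (by linarith) (by linarith)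
          rw [show x + (y - x) = y by ring] at this
          linarith
      refine ContinuousWithinAt.congr_of_eventuallyEq (f := fun _ => F x - x)
        continuousWithinAt_const ?_ rfl
      filter_upwards [self_mem_nhdsWithin,
        mem_nhdsWithin_of_mem_nhds (Iio_mem_nhds (show x < x + ε by linarith))] with y hy hy2
      exact this y hy hy2
    · obtain ⟨ε', he', h'⟩ := ev_iff.1 (hL x ⟨h0, hx.2.trans_lt hw.2⟩)
      refine ContinuousWithinAt.congr_of_eventuallyEq (f := fun _ => F x - x)
        continuousWithinAt_const ?_ rfl
      filter_upwards [mem_nhdsWithin_of_mem_nhds (Ioo_mem_nhds (show x - ε' < x by linarith)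
        (show x < x + ε by linarith))] with y hy
      rcases lt_trichotomy y x with h3 | h3 | h3
      · have := h' (x - y) (by linarith) (by linarith [hy.1])
        rw [show x - (x - y) = y by ring] at this
        linarith
      · rw [h3]
      · have := h (y - x) (by linarith) (by linarith [hy.2])
        rw [show x + (y - x) = y by ring] at this
        linarith
  · intro x hx
    obtain ⟨ε, he, h⟩ := ev_iff.1 (hR x ⟨hx.1, hx.2.trans hw.2⟩)
    refine HasDerivWithinAt.congr_of_eventuallyEq (f := fun _ => F x - x)
      (hasDerivWithinAt_const _ _ _) ?_ rfl
    filter_upwards [self_mem_nhdsWithin,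
        mem_nhdsWithin_of_mem_nhds (Iio_mem_nhds (show x < x + ε by linarith))] with y hy hy2
    rcases (show x ≤ y from hy).eq_or_lt with h3 | h3
    · rw [h3]
    · have hy2 : y < x + ε := hy2
      have := h (y - x) (by linarith) (by linarith)
      rw [show x + (y - x) = y by ring] at this
      linarith

/-- Translation on the pieces of a finite partition. -/
lemma piece_exists {k : ℕ} (β : Fin (k + 1) → ℝ) (h0 : β 0 = 0) (h1 : β (Fin.last k) = 1)
    {x : ℝ} (hx : x ∈ unitI) : ∃ i : Fin k, x ∈ Ico (β i.castSucc) (β i.succ) := by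
  by_contra hcon
  push Not at hcon
  have : ∀ i : Fin (k + 1), β i ≤ x := by
    intro i
    induction i using Fin.induction with
    | zero => rw [h0]; exact hx.1
    | succ i ih =>
      by_contra hc
      exact hcon i ⟨ih, not_le.1 hc⟩
  have := this (Fin.last k)
  rw [h1] at this
  exact absurd hx.2 (not_lt.2 this)

lemma IsIET.RC {S : ℝ → ℝ} (hS : IsIET S) {x : ℝ} (hx : x ∈ unitI) : RC S x := by
  obtain ⟨-, -, k, β, hm, h0, h1, hc⟩ := hS
  obtain ⟨i, hi⟩ := piece_exists β h0 h1 hx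
  obtain ⟨c, hc⟩ := hc i
  refine ev_iff.2 ⟨β i.succ - x, by linarith [hi.2], fun δ hd hd' => ?_⟩
  rw [hc x hi, hc (x + δ) ⟨by linarith [hi.1], by linarith⟩]
  ring

lemma IsIET.LD_finite {S : ℝ → ℝ} (hS : IsIET S) : (LD S).Finite := by
  obtain ⟨-, -, k, β, hm, h0, h1, hc⟩ := hS
  refine (Set.finite_range β).subset ?_
  rintro x ⟨hx, hx2⟩
  obtain ⟨i, hi⟩ := piece_exists β h0 h1 (x := x) ⟨hx.1.le, hx.2⟩
  obtain ⟨c, hc⟩ := hc i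
  by_contra hcon
  have hne : β i.castSucc ≠ x := fun h => hcon ⟨_, h⟩
  have hlt := lt_of_le_of_ne hi.1 hne
  refine hx2 (ev_iff.2 ⟨x - β i.castSucc, by linarith, fun δ hd hd' => ?_⟩)
  rw [hc x hi, hc (x - δ) ⟨by linarith, by linarith [hi.2]⟩]
  ring

/-- The bijection of `ℝ` given by an IET. -/
lemma IsIET.exists_perm {S : ℝ → ℝ} (hS : IsIET S) : ∃ σ : Equiv.Perm ℝ, ∀ x, σ x = S x := by
  obtain ⟨hb, ho, -⟩ := hS
  have : Function.Bijective S := by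
    constructor
    · intro x y hxy
      by_cases hx : x ∈ unitI <;> by_cases hy : y ∈ unitI
      · exact hb.injOn hx hy hxy
      · have := hb.mapsTo hx
        rw [hxy, ho y hy] at this
        exact absurd this hy
      · have := hb.mapsTo hy
        rw [← hxy, ho x hx] at this
        exact absurd this hx
      · rw [← ho x hx, ← ho y hy, hxy]
    · intro y
      by_cases hy : y ∈ unitI
      · obtain ⟨x, -, h⟩ := hb.surjOn hy
        exact ⟨x, h⟩
      · exact ⟨y, ho y hy⟩
  exact ⟨Equiv.ofBijective S this, fun x => rfl⟩

/-- Data for the tower construction over `[0,b)`. -/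
structure TD (σ : Equiv.Perm ℝ) (C : Set ℝ) (b : ℝ) (P : Finset ℝ) : Prop where
  hmap : ∀ x, σ x ∈ unitI ↔ x ∈ unitI
  hR : ∀ x ∈ unitI, RC σ x
  hb : b ∈ C
  hb0 : 0 < b
  hb1 : b < 1
  hCb : ∀ c ∈ C, c ∉ Ioo 0 b
  hLC : ∀ x ∈ Ioo (0 : ℝ) 1, x ∉ C → LC σ x
  hP : ∀ y, y ∈ P ↔ y ∈ Ioo 0 b ∧ ∃ k : ℕ, 1 ≤ k ∧ (σ ^ k) y ∈ C ∧
    ∀ i : ℕ, 0 < i → i < k → (σ ^ i) y ∉ C ∧ (σ ^ i) y ∉ Ioo 0 b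
  hdense : ∀ x ∈ unitI, ∃ k : ℤ, (σ ^ k) x ∈ Ioo 0 b

/-- `v` is the successor of `e` in `P ∪ {b}`. -/
def IsNx (P : Finset ℝ) (b e v : ℝ) : Prop :=
  v ∈ insert b P ∧ e < v ∧ ∀ z ∈ insert b P, e < z → v ≤ z

section
variable {σ : Equiv.Perm ℝ} {C : Set ℝ} {b : ℝ} {P : Finset ℝ}

lemma TD.P_lt (h : TD σ C b P) {y : ℝ} (hy : y ∈ P) : y ∈ Ioo 0 b := ((h.hP y).1 hy).1

lemma TD.E_mem (h : TD σ C b P) {e : ℝ} (he : e ∈ insert 0 P) : e ∈ Ico 0 b := by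
  rcases Finset.mem_insert.1 he with rfl | he
  · exact ⟨le_rfl, h.hb0⟩
  · exact ⟨(h.P_lt he).1.le, (h.P_lt he).2⟩

lemma TD.nx_exists (h : TD σ C b P) {e : ℝ} (he : e ∈ insert 0 P) : ∃ v, IsNx P b e v := by
  have hne : ((insert b P).filter (fun z => e < z)).Nonempty :=
    ⟨b, by simp [(h.E_mem he).2]⟩
  refine ⟨((insert b P).filter (fun z => e < z)).min' hne, ?_, ?_, ?_⟩
  · exact (Finset.mem_filter.1 (Finset.min'_mem _ hne)).1
  · exact (Finset.mem_filter.1 (Finset.min'_mem _ hne)).2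
  · intro z hz hez
    exact Finset.min'_le _ _ (Finset.mem_filter.2 ⟨hz, hez⟩)

lemma TD.pow_mem (h : TD σ C b P) (j : ℕ) (x : ℝ) : (σ ^ j) x ∈ unitI ↔ x ∈ unitI := by
  induction j with
  | zero => simp
  | succ j ih => rw [pow_succ', Equiv.Perm.mul_apply, h.hmap, ih]

lemma TD.claim (h : TD σ C b P) {e v : ℝ} (he : e ∈ insert 0 P) (hv : IsNx P b e v) (j : ℕ) :
    (∀ i : ℕ, 0 < i → i < j → b ≤ (σ ^ i) e) →
      (∀ t, 0 ≤ t → t < v - e → (σ ^ j) (e + t) = (σ ^ j) e + t) ∧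
      (∀ t, 0 < t → t < v - e → (σ ^ j) (e + t) ∉ C) := by
  have heI := h.E_mem he
  have hvb : v ≤ b := hv.2.2 b (by simp) heI.2
  have hb1 := h.hb1
  induction j using Nat.strong_induction_on with
  | _ j ih =>
  intro hj
  rcases j with _ | j
  · refine ⟨by simp, fun t h0 h1 hc => h.hCb _ hc ?_⟩
    simp only [pow_zero, Equiv.Perm.one_apply]
    exact ⟨by linarith [heI.1], by linarith⟩
  · constructor
    · obtain ⟨h1, h2⟩ := ih j (by omega) (fun i hi hi' => hj i hi (by omega))
      have hin : ∀ t, 0 ≤ t → t < v - e → (σ ^ j) e + t ∈ unitI := by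
        intro t h0 ht
        rw [← h1 t h0 ht, h.pow_mem]
        exact ⟨by linarith [heI.1], by linarith⟩
      have htr := translation_on (F := σ) (u := (σ ^ j) e) (v := (σ ^ j) e + (v - e)) ?_ ?_
      · intro t h0 ht
        rw [pow_succ', Equiv.Perm.mul_apply, Equiv.Perm.mul_apply, h1 t h0 ht,
          htr _ ⟨by linarith, by linarith⟩]
        ring
      · intro x hx
        apply h.hR
        have := hin (x - (σ ^ j) e) (by linarith [hx.1]) (by linarith [hx.2])
        simpa using this
      · intro x hx
        have h3 := hin (x - (σ ^ j) e) (by linarith [hx.1]) (by linarith [hx.2])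
        have h4 := h2 (x - (σ ^ j) e) (by linarith [hx.1]) (by linarith [hx.2])
        rw [h1 _ (by linarith [hx.1]) (by linarith [hx.2])] at h4
        have h5 := hin 0 le_rfl (by linarith [hv.2.1])
        rw [add_sub_cancel] at h3 h4
        refine h.hLC x ⟨?_, h3.2⟩ h4
        have := h5.1
        linarith [hx.1]
    · intro t h0 ht hc
      have hP : e + t ∈ P := by
        rw [h.hP]
        refine ⟨⟨by linarith [heI.1], by linarith⟩, j + 1, by omega, hc, ?_⟩
        intro i hi hi'
        obtain ⟨h1, h2⟩ := ih i (by omega) (fun i hi hi' => hj i hi (by omega))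
        refine ⟨h2 t h0 ht, fun h3 => ?_⟩
        rw [h1 t h0.le ht] at h3
        linarith [h3.2, hj i hi hi']
      have := hv.2.2 (e + t) (Finset.mem_insert_of_mem hP) (by linarith)
      linarith

lemma TD.return_exists (h : TD σ C b P) {e : ℝ} (he : e ∈ insert 0 P) :
    ∃ k : ℕ, 0 < k ∧ (σ ^ k) e ∈ Ico 0 b := by
  obtain ⟨v, hv⟩ := h.nx_exists he
  by_contra hcon
  push Not at hcon
  have heI := h.E_mem he
  have hvb : v ≤ b := hv.2.2 b (by simp) heI.2
  have hb1 := h.hb1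
  have hmem : ∀ j : ℕ, (σ ^ j) e ∈ unitI := fun j =>
    (h.pow_mem j e).2 ⟨heI.1, by linarith [heI.2]⟩
  have hge : ∀ i : ℕ, 0 < i → b ≤ (σ ^ i) e := by
    intro i hi
    by_contra hc
    exact hcon i hi ⟨(hmem i).1, not_le.1 hc⟩
  have hcl : ∀ j t, 0 ≤ t → t < v - e → (σ ^ j) (e + t) = (σ ^ j) e + t := fun j =>
    (h.claim he hv j (fun i hi _ => hge i hi)).1
  have hl : 0 < v - e := by linarith [hv.2.1]
  have hinj : Function.Injective (fun j : ℕ => ⌊(σ ^ j) e / (v - e)⌋) := by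
    have key : ∀ i j : ℕ, i < j → |(σ ^ i) e - (σ ^ j) e| < v - e → False := by
      intro i j hij habs
      obtain ⟨d, rfl⟩ : ∃ d, j = i + d := ⟨j - i, by omega⟩
      have hd : 0 < d := by omega
      have hsp : ∀ x, (σ ^ (i + d)) x = (σ ^ i) ((σ ^ d) x) := by
        intro x; rw [pow_add, Equiv.Perm.mul_apply]
      rw [abs_lt] at habs
      rcases le_total ((σ ^ i) e) ((σ ^ (i + d)) e) with hle | hle
      · have h1 := hcl i ((σ ^ (i + d)) e - (σ ^ i) e) (by linarith) (by linarith)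
        rw [add_sub_cancel, hsp e] at h1
        have h2 := (σ ^ i).injective h1
        rw [← hsp e] at h2
        have := hge d hd
        linarith
      · have h1 := hcl (i + d) ((σ ^ i) e - (σ ^ (i + d)) e) (by linarith) (by linarith)
        rw [add_sub_cancel, hsp] at h1
        have h2 := (σ ^ i).injective h1
        rw [hcl d _ (by linarith) (by linarith)] at h2
        have := hge d hd
        linarith [heI.2]
    intro i j hij
    have habs := Int.abs_sub_lt_one_of_floor_eq_floor hij
    rw [← sub_div, abs_div, abs_of_pos hl, div_lt_one hl] at habs
    rcases lt_trichotomy i j with h1 | h1 | h1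
    · exact (key i j h1 habs).elim
    · exact h1
    · exact (key j i h1 (by rwa [abs_sub_comm])).elim
  have hfin : (Set.range (fun j : ℕ => ⌊(σ ^ j) e / (v - e)⌋)).Finite := by
    refine (Set.finite_Icc (0 : ℤ) ⌊1 / (v - e)⌋).subset ?_
    rintro _ ⟨j, rfl⟩
    have h1 := hmem j
    exact ⟨Int.floor_nonneg.2 (div_nonneg h1.1 hl.le),
      Int.floor_le_floor (div_le_div_of_nonneg_right h1.2.le hl.le)⟩
  exact Set.infinite_range_of_injective hinj hfin

lemma exists_right_gap {ι : Type*} (I : Finset ι) (u l : ι → ℝ) (x : ℝ)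
    (hx : ∀ i ∈ I, x ∉ Ico (u i) (u i + l i)) :
    ∃ ε > 0, ∀ i ∈ I, ∀ y ∈ Ico x (x + ε), y ∉ Ico (u i) (u i + l i) := by
  classical
  induction I using Finset.induction_on with
  | empty => exact ⟨1, one_pos, by simp⟩
  | insert a I ha ih =>
    obtain ⟨ε, he, h⟩ := ih (fun i hi => hx i (Finset.mem_insert_of_mem hi))
    have hxa := hx a (Finset.mem_insert_self _ _)
    by_cases hlt : x < u a
    · refine ⟨min ε (u a - x), lt_min he (by linarith), ?_⟩
      intro i hi y hy
      have h1 := min_le_left ε (u a - x)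
      have h2 := min_le_right ε (u a - x)
      rcases Finset.mem_insert.1 hi with rfl | hi
      · intro h3; linarith [h3.1, hy.2]
      · exact h i hi y ⟨hy.1, by linarith [hy.2]⟩
    · refine ⟨ε, he, ?_⟩
      intro i hi y hy
      rcases Finset.mem_insert.1 hi with rfl | hi
      · intro h3
        exact hxa ⟨not_lt.1 hlt, by linarith [h3.2, hy.1]⟩
      · exact h i hi y hy

/-- Two finite disjoint families of intervals with the same lengths: if the second union is
contained in the first, they are equal. -/
lemma union_eq {ι : Type*} (I : Finset ι) (u u' l : ι → ℝ)
    (hd : (I : Set ι).PairwiseDisjoint (fun i => Ico (u i) (u i + l i)))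
    (hd' : (I : Set ι).PairwiseDisjoint (fun i => Ico (u' i) (u' i + l i)))
    (hsub : (⋃ i ∈ I, Ico (u' i) (u' i + l i)) ⊆ ⋃ i ∈ I, Ico (u i) (u i + l i)) :
    (⋃ i ∈ I, Ico (u i) (u i + l i)) ⊆ ⋃ i ∈ I, Ico (u' i) (u' i + l i) := by
  intro x hx
  by_contra hx'
  have hx0 := hx
  simp only [Set.mem_iUnion, not_exists] at hx hx'
  obtain ⟨i, hi, hxi⟩ := hx
  obtain ⟨ε, he, hgap⟩ := exists_right_gap I u' l x (fun i hi => hx' i hi)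
  set ε' := min ε (u i + l i - x) with hε'
  have he' : 0 < ε' := lt_min he (by linarith [hxi.2])
  have hdj : Disjoint (⋃ i ∈ I, Ico (u' i) (u' i + l i)) (Ico x (x + ε')) := by
    rw [Set.disjoint_left]
    intro y hy hy2
    simp only [Set.mem_iUnion] at hy
    obtain ⟨k, hk, hyk⟩ := hy
    exact hgap k hk y ⟨hy2.1, by linarith [hy2.2, min_le_left ε (u i + l i - x)]⟩ hyk
  have hss : (⋃ i ∈ I, Ico (u' i) (u' i + l i)) ∪ Ico x (x + ε') ⊆
      ⋃ i ∈ I, Ico (u i) (u i + l i) := by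
    apply Set.union_subset hsub
    intro y hy
    simp only [Set.mem_iUnion]
    exact ⟨i, hi, by linarith [hxi.1, hy.1],
      by linarith [hy.2, min_le_right ε (u i + l i - x)]⟩
  have hm := measure_mono (μ := volume) hss
  rw [measure_union hdj measurableSet_Ico,
    measure_biUnion_finset hd (fun _ _ => measurableSet_Ico),
    measure_biUnion_finset hd' (fun _ _ => measurableSet_Ico)] at hm
  simp only [Real.volume_Ico, add_sub_cancel_left] at hm
  have hfin : ∑ i ∈ I, ENNReal.ofReal (l i) ≠ ⊤ :=
    ENNReal.sum_ne_top.2 (fun _ _ => ENNReal.ofReal_ne_top)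
  have hpos : ENNReal.ofReal ε' ≠ 0 := by simpa using he'
  exact absurd hm (not_le.2 (ENNReal.lt_add_right hfin hpos))

/-- If a finite disjoint family of intervals covers `[0,1)` and none is cut by `c`, then `c` is
a sum of lengths. -/
lemma cut_mem {ι : Type*} (I : Finset ι) (u l : ι → ℝ) (W : Submodule ℚ ℝ)
    (hd : (I : Set ι).PairwiseDisjoint (fun i => Ico (u i) (u i + l i)))
    (hl : ∀ i ∈ I, 0 < l i)
    (hcov : unitI ⊆ ⋃ i ∈ I, Ico (u i) (u i + l i)) (hW : ∀ i ∈ I, l i ∈ W)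
    (h0 : ∀ i ∈ I, 0 ≤ u i)
    (c : ℝ) (hc0 : 0 ≤ c) (hc1 : c ≤ 1) (hc : ∀ i ∈ I, c ∉ Ioo (u i) (u i + l i)) : c ∈ W := by
  have h1 : Ico 0 c = ⋃ i ∈ I, (Ico 0 c ∩ Ico (u i) (u i + l i)) := by
    ext y
    simp only [Set.mem_iUnion, Set.mem_inter_iff]
    constructor
    · intro hy
      have := hcov (show y ∈ unitI from ⟨hy.1, hy.2.trans_le hc1⟩)
      simp only [Set.mem_iUnion] at this
      obtain ⟨i, hi, h⟩ := this
      exact ⟨i, hi, hy, h⟩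
    · rintro ⟨i, hi, hy, -⟩
      exact hy
  have h2 : volume.real (Ico 0 c) = ∑ i ∈ I, volume.real (Ico 0 c ∩ Ico (u i) (u i + l i)) := by
    conv_lhs => rw [h1]
    apply measureReal_biUnion_finset
    · intro i hi j hj hij
      exact (hd hi hj hij).mono Set.inter_subset_right Set.inter_subset_right
    · intro i _
      exact measurableSet_Ico.inter measurableSet_Ico
    · intro i _
      exact ne_top_of_le_ne_top (by simp) (measure_mono (μ := volume) Set.inter_subset_right)
  have h3 : volume.real (Ico 0 c) = c := by simp [hc0]
  rw [← h3, h2]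
  apply Submodule.sum_mem
  intro i hi
  rcases le_or_gt c (u i) with hci | hci
  · have : Ico 0 c ∩ Ico (u i) (u i + l i) = ∅ := by
      ext y; simp; intro _ h4 h5; linarith
    rw [this]; simp
  · have : Ico 0 c ∩ Ico (u i) (u i + l i) = Ico (u i) (u i + l i) := by
      apply Set.inter_eq_right.2
      intro y hy
      have : u i + l i ≤ c := by
        by_contra h5
        exact hc i hi ⟨hci, not_le.1 h5⟩
      exact ⟨by linarith [h0 i hi, hy.1], by linarith [hy.2]⟩
    rw [this]
    have := hl i hi
    simpa [this.le] using hW i hi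

theorem TD.main (h : TD σ C b P) (c : ℝ) (hc : (c ∈ C ∧ c ∈ unitI) ∨ c = 1) :
    c ∈ Submodule.span ℚ ((insert b P : Finset ℝ) : Set ℝ) := by
  classical
  have hb1 := h.hb1
  have hb0 := h.hb0
  have hnx : ∀ e : ℝ, ∃ v, e ∈ insert 0 P → IsNx P b e v := by
    intro e
    by_cases he : e ∈ insert 0 P
    · obtain ⟨v, hv⟩ := h.nx_exists he; exact ⟨v, fun _ => hv⟩
    · exact ⟨0, fun h => absurd h he⟩
  choose v hv using hnx
  have hret : ∀ e : ℝ, ∃ k : ℕ, e ∈ insert 0 P → (0 < k ∧ (σ ^ k) e ∈ Ico 0 b ∧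
      ∀ i : ℕ, 0 < i → i < k → b ≤ (σ ^ i) e) := by
    intro e
    by_cases he : e ∈ insert 0 P
    · have hex := h.return_exists he
      refine ⟨Nat.find hex, fun _ => ⟨(Nat.find_spec hex).1, (Nat.find_spec hex).2, ?_⟩⟩
      intro i hi hi'
      by_contra hcon
      have heI := h.E_mem he
      have := (h.pow_mem i e).2 ⟨heI.1, by linarith [heI.2]⟩
      exact Nat.find_min hex hi' ⟨hi, this.1, not_le.1 hcon⟩
    · exact ⟨0, fun h => absurd h he⟩
  choose r hr using hret
  set E : Finset ℝ := insert 0 P with hE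
  -- translation on levels
  have htr : ∀ e ∈ E, ∀ j ≤ r e, ∀ t, 0 ≤ t → t < v e - e → (σ ^ j) (e + t) = (σ ^ j) e + t :=
    fun e he j hj => (h.claim he (hv e he) j
      (fun i hi hi' => (hr e he).2.2 i hi (by omega))).1
  have hCav : ∀ e ∈ E, ∀ j ≤ r e, ∀ t, 0 < t → t < v e - e → (σ ^ j) (e + t) ∉ C :=
    fun e he j hj => (h.claim he (hv e he) j
      (fun i hi hi' => (hr e he).2.2 i hi (by omega))).2
  have hvb : ∀ e ∈ E, v e ≤ b := fun e he => (hv e he).2.2 b (by simp) (h.E_mem he).2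
  have hev : ∀ e ∈ E, e < v e := fun e he => (hv e he).2.1
  -- base covering
  have hbase : ∀ y ∈ Ico 0 b, ∃ e ∈ E, y ∈ Ico e (v e) := by
    intro y hy
    have hne : (E.filter (fun z => z ≤ y)).Nonempty := ⟨0, by simp [hE, hy.1]⟩
    have hmem := Finset.mem_filter.1 (Finset.max'_mem _ hne)
    refine ⟨(E.filter (fun z => z ≤ y)).max' hne, hmem.1, hmem.2, ?_⟩
    set e := (E.filter (fun z => z ≤ y)).max' hne with he
    by_contra hcon
    rw [not_lt] at hcon
    rcases Finset.mem_insert.1 (hv e hmem.1).1 with h1 | h1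
    · rw [h1] at hcon; linarith [hy.2]
    · have := Finset.le_max' (E.filter (fun z => z ≤ y)) (v e)
        (Finset.mem_filter.2 ⟨Finset.mem_insert_of_mem h1, hcon⟩)
      linarith [hev e hmem.1]
  have hbase_inj : ∀ e ∈ E, ∀ e' ∈ E, ∀ y, y ∈ Ico e (v e) → y ∈ Ico e' (v e') → e = e' := by
    have aux : ∀ e ∈ E, ∀ e' ∈ E, ∀ y, y ∈ Ico e (v e) → y ∈ Ico e' (v e') → e' ≤ e := by
      intro e he e' he' y hy hy'
      by_contra hcon
      rw [not_le] at hcon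
      rcases Finset.mem_insert.1 he' with h1 | h1
      · linarith [(h.E_mem he).1]
      · have := (hv e he).2.2 e' (Finset.mem_insert_of_mem h1) hcon
        linarith [hy.2, hy'.1]
    intro e he e' he' y hy hy'
    exact le_antisymm (aux e' he' e he y hy' hy) (aux e he e' he' y hy hy')
  set I : Finset (Σ _ : ℝ, ℕ) := E.sigma (fun e => Finset.range (r e)) with hI
  have hImem : ∀ i ∈ I, i.1 ∈ E ∧ i.2 < r i.1 := by
    intro i hi
    simpa [hI] using hi
  set u : (Σ _ : ℝ, ℕ) → ℝ := fun i => (σ ^ i.2) i.1 with hu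
  set u' : (Σ _ : ℝ, ℕ) → ℝ := fun i => (σ ^ (i.2 + 1)) i.1 with hu'
  set l : (Σ _ : ℝ, ℕ) → ℝ := fun i => v i.1 - i.1 with hl
  have hlev : ∀ e ∈ E, ∀ j ≤ r e, ∀ x, x ∈ Ico ((σ ^ j) e) ((σ ^ j) e + (v e - e)) ↔
      ∃ y ∈ Ico e (v e), (σ ^ j) y = x := by
    intro e he j hj x
    constructor
    · intro hx
      refine ⟨e + (x - (σ ^ j) e), ⟨by linarith [hx.1], by linarith [hx.2]⟩, ?_⟩
      rw [htr e he j hj _ (by linarith [hx.1]) (by linarith [hx.2])]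
      ring
    · rintro ⟨y, hy, rfl⟩
      have := htr e he j hj (y - e) (by linarith [hy.1]) (by linarith [hy.2])
      rw [add_sub_cancel] at this
      rw [this]
      exact ⟨by linarith [hy.1], by linarith [hy.2]⟩
  have hbig : ∀ e ∈ E, ∀ j, 0 < j → j < r e → ∀ y ∈ Ico e (v e), b ≤ (σ ^ j) y := by
    intro e he j hj hj' y hy
    have := htr e he j hj'.le (y - e) (by linarith [hy.1]) (by linarith [hy.2])
    rw [add_sub_cancel] at this
    rw [this]
    linarith [(hr e he).2.2 j hj hj', hy.1]
  have huniq : ∀ e ∈ E, ∀ e' ∈ E, ∀ j < r e, ∀ j' < r e', ∀ y ∈ Ico e (v e),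
      ∀ y' ∈ Ico e' (v e'), j ≤ j' → (σ ^ j) y = (σ ^ j') y' → e = e' ∧ j = j' := by
    intro e he e' he' j hj j' hj' y hy y' hy' hle heq
    obtain ⟨d, rfl⟩ : ∃ d, j' = j + d := ⟨j' - j, by omega⟩
    rw [pow_add, Equiv.Perm.mul_apply] at heq
    have heq := (σ ^ j).injective heq
    rcases Nat.eq_zero_or_pos d with rfl | hd
    · simp only [pow_zero, Equiv.Perm.one_apply] at heq
      subst heq
      exact ⟨hbase_inj e he e' he' y hy hy', rfl⟩
    · have h1 := hbig e' he' d hd (by omega) y' hy'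
      have h2 := hvb e he
      linarith [hy.2]
  have hdisj : ∀ i ∈ I, ∀ i' ∈ I, ∀ y ∈ Ico i.1 (v i.1), ∀ y' ∈ Ico i'.1 (v i'.1),
      (σ ^ i.2) y = (σ ^ i'.2) y' → i = i' := by
    rintro ⟨e, j⟩ hi ⟨e', j'⟩ hi' y hy y' hy' heq
    obtain ⟨he, hj⟩ := hImem _ hi
    obtain ⟨he', hj'⟩ := hImem _ hi'
    rcases le_total j j' with hle | hle
    · obtain ⟨rfl, rfl⟩ := huniq e he e' he' j hj j' hj' y hy y' hy' hle heq
      rfl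
    · obtain ⟨rfl, rfl⟩ := huniq e' he' e he j' hj' j hj y' hy' y hy hle heq.symm
      rfl
  have hd : (I : Set (Σ _ : ℝ, ℕ)).PairwiseDisjoint (fun i => Ico (u i) (u i + l i)) := by
    intro i hi i' hi' hne
    rw [Function.onFun, Set.disjoint_left]
    intro x hx hx'
    obtain ⟨y, hy, rfl⟩ := (hlev i.1 (hImem i hi).1 i.2 (hImem i hi).2.le x).1 hx
    obtain ⟨y', hy', heq⟩ := (hlev i'.1 (hImem i' hi').1 i'.2 (hImem i' hi').2.le _).1 hx'
    exact hne (hdisj i hi i' hi' y hy y' hy' heq.symm)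
  have hd' : (I : Set (Σ _ : ℝ, ℕ)).PairwiseDisjoint (fun i => Ico (u' i) (u' i + l i)) := by
    intro i hi i' hi' hne
    rw [Function.onFun, Set.disjoint_left]
    intro x hx hx'
    obtain ⟨y, hy, rfl⟩ := (hlev i.1 (hImem i hi).1 (i.2 + 1) (hImem i hi).2 x).1 hx
    obtain ⟨y', hy', heq⟩ := (hlev i'.1 (hImem i' hi').1 (i'.2 + 1) (hImem i' hi').2 _).1 hx'
    rw [pow_succ', pow_succ', Equiv.Perm.mul_apply, Equiv.Perm.mul_apply] at heq
    exact hne (hdisj i hi i' hi' y hy y' hy' (σ.injective heq).symm)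
  have hmemU : ∀ x, x ∈ (⋃ i ∈ I, Ico (u i) (u i + l i)) ↔
      ∃ i ∈ I, ∃ y ∈ Ico i.1 (v i.1), (σ ^ i.2) y = x := by
    intro x
    simp only [Set.mem_iUnion, exists_prop]
    refine exists_congr fun i => and_congr_right fun hi => ?_
    exact hlev i.1 (hImem i hi).1 i.2 (hImem i hi).2.le x
  have hmemU' : ∀ x, x ∈ (⋃ i ∈ I, Ico (u' i) (u' i + l i)) ↔
      ∃ i ∈ I, ∃ y ∈ Ico i.1 (v i.1), (σ ^ (i.2 + 1)) y = x := by
    intro x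
    simp only [Set.mem_iUnion, exists_prop]
    refine exists_congr fun i => and_congr_right fun hi => ?_
    exact hlev i.1 (hImem i hi).1 (i.2 + 1) (hImem i hi).2 x
  have hJU : ∀ y ∈ Ico 0 b, y ∈ ⋃ i ∈ I, Ico (u i) (u i + l i) := by
    intro y hy
    obtain ⟨e, he, hye⟩ := hbase y hy
    rw [hmemU]
    refine ⟨⟨e, 0⟩, ?_, y, hye, by simp⟩
    simp only [hI, Finset.mem_sigma, Finset.mem_range]
    exact ⟨he, (hr e he).1⟩
  have hsub : (⋃ i ∈ I, Ico (u' i) (u' i + l i)) ⊆ ⋃ i ∈ I, Ico (u i) (u i + l i) := by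
    intro x hx
    obtain ⟨⟨e, j⟩, hi, y, hy, rfl⟩ := (hmemU' x).1 hx
    obtain ⟨he, hj⟩ := hImem _ hi
    simp only at he hj hy
    rcases (Nat.succ_le_of_lt hj).eq_or_lt with hj2 | hj2
    · apply hJU
      simp only [Nat.succ_eq_add_one] at hj2
      simp only [hj2]
      have h1 := htr e he (r e) le_rfl
      obtain ⟨h2, h3⟩ := (hr e he).2.1
      have h4 := h1 (y - e) (by linarith [hy.1]) (by linarith [hy.2])
      rw [add_sub_cancel] at h4
      rw [h4]
      refine ⟨by linarith [hy.1], ?_⟩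
      by_contra hcon
      rw [not_lt] at hcon
      have h5 := hCav e he (r e) le_rfl (b - (σ ^ (r e)) e) (by linarith) (by linarith [hy.2])
      rw [h1 _ (by linarith) (by linarith [hy.2]), add_sub_cancel] at h5
      exact h5 h.hb
    · rw [hmemU]
      refine ⟨⟨e, j + 1⟩, ?_, y, hy, rfl⟩
      simp only [hI, Finset.mem_sigma, Finset.mem_range]
      exact ⟨he, hj2⟩
  have hsup := union_eq I u u' l hd hd' hsub
  set U := ⋃ i ∈ I, Ico (u i) (u i + l i) with hU
  have hfw : ∀ x, σ x ∈ U ↔ x ∈ U := by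
    intro x
    constructor
    · intro hx
      obtain ⟨i, hi, y, hy, heq⟩ := (hmemU' _).1 (hsup hx)
      rw [pow_succ', Equiv.Perm.mul_apply] at heq
      rw [hmemU]
      exact ⟨i, hi, y, hy, σ.injective heq⟩
    · intro hx
      obtain ⟨i, hi, y, hy, rfl⟩ := (hmemU _).1 hx
      apply hsub
      rw [hmemU']
      exact ⟨i, hi, y, hy, by rw [pow_succ', Equiv.Perm.mul_apply]⟩
  have hzp : ∀ (k : ℤ) (x : ℝ), (σ ^ k) x ∈ U ↔ x ∈ U := by
    have hn : ∀ (k : ℕ) (x : ℝ), (σ ^ k) x ∈ U ↔ x ∈ U := by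
      intro k x
      induction k with
      | zero => simp
      | succ k ih => rw [pow_succ', Equiv.Perm.mul_apply, hfw, ih]
    intro k x
    rcases Int.eq_nat_or_neg k with ⟨j, rfl | rfl⟩
    · rw [zpow_natCast, hn]
    · rw [← hn j ((σ ^ (-(j : ℤ))) x), zpow_neg, zpow_natCast, ← Equiv.Perm.mul_apply, mul_inv_cancel,
        Equiv.Perm.one_apply]
  have hcov : unitI ⊆ U := by
    intro x hx
    obtain ⟨k, hk⟩ := h.hdense x hx
    exact (hzp k x).1 (hJU _ ⟨hk.1.le, hk.2⟩)
  have hunit : ∀ e ∈ E, ∀ y ∈ Ico e (v e), ∀ j : ℕ, (σ ^ j) y ∈ unitI := by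
    intro e he y hy j
    exact (h.pow_mem j y).2 ⟨by linarith [(h.E_mem he).1, hy.1], by linarith [hvb e he, hy.2]⟩
  refine cut_mem I u l _ hd (fun i hi => sub_pos.2 (hev _ (hImem i hi).1)) hcov ?_ ?_ c ?_ ?_ ?_
  · intro i hi
    refine Submodule.sub_mem _ (Submodule.subset_span (hv _ (hImem i hi).1).1) ?_
    rcases Finset.mem_insert.1 (hImem i hi).1 with h1 | h1
    · rw [h1]; exact Submodule.zero_mem _
    · exact Submodule.subset_span (Finset.mem_insert_of_mem h1)
  · intro i hi
    exact (hunit i.1 (hImem i hi).1 i.1 ⟨le_rfl, hev _ (hImem i hi).1⟩ i.2).1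
  · rcases hc with hc | rfl
    · exact hc.2.1
    · exact zero_le_one
  · rcases hc with hc | rfl
    · exact hc.2.2.le
    · exact le_rfl
  · intro i hi hci
    obtain ⟨he, hj⟩ := hImem i hi
    have h1 : c ∈ Ico (u i) (u i + l i) := ⟨hci.1.le, hci.2⟩
    obtain ⟨y, hy, hyc⟩ := (hlev i.1 he i.2 hj.le c).1 h1
    have h2 := hunit i.1 he y hy i.2
    rw [hyc] at h2
    rcases hc with hc | rfl
    · have hne : i.1 ≠ y := by
        rintro rfl
        exact absurd hyc (ne_of_lt hci.1)
      have hlt := lt_of_le_of_ne hy.1 hne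
      have := hCav i.1 he i.2 hj.le (y - i.1) (by linarith) (by linarith [hy.2])
      rw [add_sub_cancel, hyc] at this
      exact this hc.1
    · exact absurd h2.2 (lt_irrefl _)

end

section
variable {σ : Equiv.Perm ℝ}

lemma zpow_mem_unit (hmap : ∀ x, σ x ∈ unitI ↔ x ∈ unitI) (k : ℤ) (x : ℝ) :
    (σ ^ k) x ∈ unitI ↔ x ∈ unitI := by
  have hn : ∀ (k : ℕ) (x : ℝ), (σ ^ k) x ∈ unitI ↔ x ∈ unitI := by
    intro k x
    induction k with
    | zero => simp
    | succ k ih => rw [pow_succ', Equiv.Perm.mul_apply, hmap, ih]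
  rcases Int.eq_nat_or_neg k with ⟨j, rfl | rfl⟩
  · rw [zpow_natCast, hn]
  · rw [← hn j ((σ ^ (-(j : ℤ))) x), zpow_neg, zpow_natCast, ← Equiv.Perm.mul_apply,
      mul_inv_cancel, Equiv.Perm.one_apply]

lemma LC_pow {x : ℝ} (k : ℕ) (h : ∀ i < k, LC σ ((σ ^ i) x)) : LC (σ ^ k : Equiv.Perm ℝ) x := by
  induction k with
  | zero => simp [LC]
  | succ k ih =>
    have := (ih (fun i hi => h i (by omega))).comp (h k (by omega))
    refine Filter.Eventually.mono this ?_
    intro δ hδ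
    simpa [pow_succ'] using hδ

/-- An `S`-orbit which contains a discontinuity of `S` but not `0` contains two
discontinuities of `S^n`. -/
lemma two_discs (hmap : ∀ x, σ x ∈ unitI ↔ x ∈ unitI) (hfin : (LD σ).Finite)
    (hap : ∀ x ∈ unitI, ∀ k : ℤ, (σ ^ k) x = x → k = 0) {n : ℕ} (hn : 2 ≤ n) {x : ℝ}
    (hx : x ∈ LD σ) (h0 : ¬ σ.SameCycle x 0) :
    ∃ f g, f ≠ g ∧ f ∈ LD (σ ^ n : Equiv.Perm ℝ) ∧ g ∈ LD (σ ^ n : Equiv.Perm ℝ) ∧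
      σ.SameCycle x f ∧ σ.SameCycle x g := by
  have hxu : x ∈ unitI := ⟨hx.1.1.le, hx.1.2⟩
  have hinj : Function.Injective (fun k : ℤ => (σ ^ k) x) := by
    intro i j hij
    simp only at hij
    have : (σ ^ (i - j)) x = x := by
      rw [sub_eq_neg_add, zpow_add, Equiv.Perm.mul_apply, hij, ← Equiv.Perm.mul_apply, ← zpow_add]
      simp
    have := hap x hxu _ this
    omega
  have hfin2 : {k : ℤ | (σ ^ k) x ∈ LD σ}.Finite := hfin.preimage hinj.injOn
  have hne : hfin2.toFinset.Nonempty := ⟨0, by simpa using hx⟩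
  set A := hfin2.toFinset with hA
  have hin : ∀ k : ℤ, (σ ^ k) x ∈ Ioo (0 : ℝ) 1 := by
    intro k
    have h1 := (zpow_mem_unit hmap k x).2 hxu
    refine ⟨lt_of_le_of_ne h1.1 (fun h => h0 ⟨k, h.symm⟩), h1.2⟩
  have hlc : ∀ k : ℤ, k ∉ A → LC σ ((σ ^ k) x) := by
    intro k hk
    by_contra hc
    exact hk (by simpa [hA] using (show (σ ^ k) x ∈ LD σ from ⟨hin k, hc⟩))
  have hstep : ∀ (k : ℤ) (i : ℕ), (σ ^ i) ((σ ^ k) x) = (σ ^ (k + i)) x := by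
    intro k i
    rw [add_comm, zpow_add, Equiv.Perm.mul_apply, zpow_natCast]
  obtain ⟨n, rfl⟩ : ∃ n', n = n' + 1 := ⟨n - 1, by omega⟩
  set a := A.min' hne with ha
  set z := A.max' hne with hz
  have haz : a ≤ z := Finset.min'_le _ _ (Finset.max'_mem _ _)
  have haA : (σ ^ a) x ∈ LD σ := by
    have := Finset.min'_mem A hne; simpa [hA] using this
  have hzA : (σ ^ z) x ∈ LD σ := by
    have := Finset.max'_mem A hne; simpa [hA] using this
  refine ⟨(σ ^ (a - n)) x, (σ ^ z) x, ?_, ⟨hin _, ?_⟩, ⟨hin _, ?_⟩, ⟨_, rfl⟩, ⟨_, rfl⟩⟩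
  · intro h
    have := hinj h
    omega
  · intro hT
    apply haA.2
    have h1 : LC (σ ^ n : Equiv.Perm ℝ) ((σ ^ (a - n)) x) := by
      apply LC_pow
      intro i hi
      rw [hstep]
      apply hlc
      intro hc
      have := Finset.min'_le _ _ hc
      omega
    unfold LC at *
    filter_upwards [h1, hT] with δ h1 h2
    have e1 := hstep (a - n) n
    rw [sub_add_cancel] at e1
    simp only [pow_succ', Equiv.Perm.mul_apply] at h2
    rw [h1, e1] at h2
    exact h2
  · intro hT
    apply hzA.2
    have e1 : σ ((σ ^ z) x) = (σ ^ (z + 1)) x := by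
      have := hstep z 1
      simpa using this
    have h1 : LC (σ ^ n : Equiv.Perm ℝ) (σ ((σ ^ z) x)) := by
      apply LC_pow
      intro i hi
      rw [e1, hstep]
      apply hlc
      intro hc
      have := Finset.le_max' _ _ hc
      omega
    unfold LC at *
    filter_upwards [h1, hT] with δ h1 h2
    simp only [pow_succ, Equiv.Perm.mul_apply] at h2
    rw [← h1] at h2
    exact (σ ^ n).injective h2

lemma zero_disc (hmap : ∀ x, σ x ∈ unitI ↔ x ∈ unitI)
    (hap : ∀ x ∈ unitI, ∀ k : ℤ, (σ ^ k) x = x → k = 0) {n : ℕ} (hn : 1 ≤ n) :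
    (σ ^ (-(n : ℤ))) 0 ∈ LD (σ ^ n : Equiv.Perm ℝ) := by
  have h0 : (0 : ℝ) ∈ unitI := ⟨le_rfl, one_pos⟩
  have h1 := (zpow_mem_unit hmap (-(n : ℤ)) 0).2 h0
  have hpos : 0 < (σ ^ (-(n : ℤ))) 0 := by
    refine lt_of_le_of_ne h1.1 (fun h => ?_)
    have := hap 0 h0 _ h.symm
    omega
  refine ⟨⟨hpos, h1.2⟩, fun hL => ?_⟩
  obtain ⟨ε, he, h⟩ := ev_iff.1 hL
  set w := (σ ^ (-(n : ℤ))) 0 with hw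
  have hw0 : (σ ^ n) w = 0 := by
    rw [hw, zpow_neg, zpow_natCast, ← Equiv.Perm.mul_apply, mul_inv_cancel, Equiv.Perm.one_apply]
  have hδ : 0 < min ε w / 2 := by have := lt_min he hpos; linarith
  have h2 := h (min ε w / 2) hδ (by linarith [min_le_left ε w])
  rw [hw0] at h2
  have h3 := (zpow_mem_unit hmap n (w - min ε w / 2)).2
    ⟨by linarith [min_le_right ε w], by linarith [h1.2]⟩
  rw [zpow_natCast, h2] at h3
  linarith [h3.1]

theorem count (hmap : ∀ x, σ x ∈ unitI ↔ x ∈ unitI) (hR : ∀ x ∈ unitI, RC σ x)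
    (hfin : (LD σ).Finite)
    (hap : ∀ x ∈ unitI, ∀ k : ℤ, (σ ^ k) x = x → k = 0)
    (hdense : ∀ b : ℝ, 0 < b → b < 1 → ∀ x ∈ unitI, ∃ k : ℤ, (σ ^ k) x ∈ Ioo 0 b)
    {n : ℕ} (hn : 2 ≤ n) (hfinT : (LD (σ ^ n : Equiv.Perm ℝ)).Finite) :
    ∃ Q : Finset ℝ, 2 * Q.card ≤ (LD (σ ^ n : Equiv.Perm ℝ)).ncard + 3 ∧
      ∀ c, c ∈ LD (σ ^ n : Equiv.Perm ℝ) ∨ c = 1 →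
        c ∈ Submodule.span ℚ (Q : Set ℝ) := by
  classical
  set D := LD (σ ^ n : Equiv.Perm ℝ) with hD
  have h0u : (0 : ℝ) ∈ unitI := ⟨le_rfl, one_pos⟩
  set B : Set ℝ := insert 0 (LD σ ∪ D) with hB
  have hBfin : B.Finite := (hfin.union hfinT).insert 0
  have hBu : ∀ x ∈ B, x ∈ unitI := by
    rintro x (rfl | h | h)
    · exact h0u
    · exact ⟨h.1.1.le, h.1.2⟩
    · exact ⟨h.1.1.le, h.1.2⟩
  have hinj : ∀ x ∈ unitI, ∀ i j : ℕ, (σ ^ i) x = (σ ^ j) x → i = j := by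
    intro x hx i j hij
    have : (σ ^ ((i : ℤ) - j)) x = x := by
      rw [sub_eq_neg_add, zpow_add, Equiv.Perm.mul_apply, zpow_natCast, hij, ← zpow_natCast,
        ← Equiv.Perm.mul_apply, ← zpow_add]
      simp
    have := hap x hx _ this
    omega
  set C : Set ℝ := {z | ∃ x ∈ B, ∃ y ∈ B, ∃ i j : ℕ, (σ ^ i) x = z ∧ (σ ^ j) z = y} with hC
  have hBC : B ⊆ C := fun x hx => ⟨x, hx, x, hx, 0, 0, by simp, by simp⟩
  have hCu : ∀ x ∈ C, x ∈ unitI := by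
    rintro z ⟨x, hx, y, hy, i, j, rfl, h⟩
    have := (zpow_mem_unit hmap i x).2 (hBu x hx)
    simpa using this
  have hCfin : C.Finite := by
    have hsub : C ⊆ ⋃ x ∈ B, ⋃ y ∈ B, {z | ∃ i j : ℕ, (σ ^ i) x = z ∧ (σ ^ j) z = y} := by
      rintro z ⟨x, hx, y, hy, h⟩
      simp only [Set.mem_iUnion]
      exact ⟨x, hx, y, hy, h⟩
    refine Set.Finite.subset ?_ hsub
    refine hBfin.biUnion fun x hx => hBfin.biUnion fun y hy => ?_
    by_cases hex : ∃ k : ℕ, (σ ^ k) x = y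
    · obtain ⟨k, hk⟩ := hex
      refine ((Set.finite_Iic k).image (fun i => (σ ^ i) x)).subset ?_
      rintro z ⟨i, j, rfl, h⟩
      refine ⟨i, ?_, rfl⟩
      rw [← Equiv.Perm.mul_apply, ← pow_add, ← hk] at h
      have := hinj x (hBu x hx) _ _ h
      simp only [Set.mem_Iic]
      omega
    · refine Set.finite_empty.subset ?_
      rintro z ⟨i, j, rfl, h⟩
      rw [← Equiv.Perm.mul_apply, ← pow_add] at h
      exact hex ⟨_, h⟩
  have hconv : ∀ x ∈ C, ∀ i k : ℕ, i ≤ k → (σ ^ k) x ∈ C → (σ ^ i) x ∈ C := by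
    rintro z ⟨x, hx, -, -, i, -, rfl, -⟩ i' k hik ⟨-, -, y, hy, -, j, -, h⟩
    refine ⟨x, hx, y, hy, i' + i, j + (k - i'), ?_, ?_⟩
    · rw [pow_add, Equiv.Perm.mul_apply]
    · rw [← h, pow_add, Equiv.Perm.mul_apply, ← Equiv.Perm.mul_apply (σ ^ (k - i')), ← pow_add,
        Nat.sub_add_cancel hik]
  -- choose b
  have hT0 := zero_disc hmap hap (n := n) (by omega)
  have hne : (hCfin.toFinset.filter (fun z => 0 < z)).Nonempty := by
    refine ⟨(σ ^ (-(n : ℤ))) 0, ?_⟩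
    simp only [Finset.mem_filter, Set.Finite.mem_toFinset]
    exact ⟨hBC (Or.inr (Or.inr hT0)), hT0.1.1⟩
  set b := (hCfin.toFinset.filter (fun z => 0 < z)).min' hne with hbdef
  have hbm : b ∈ C ∧ 0 < b := by
    have := Finset.min'_mem _ hne
    simpa only [Finset.mem_filter, Set.Finite.mem_toFinset] using this
  have hb1 : b < 1 := (hCu b hbm.1).2
  have hCb : ∀ c ∈ C, c ∉ Ioo 0 b := by
    intro c hc hcb
    have := Finset.min'_le (hCfin.toFinset.filter (fun z => 0 < z)) c
      (by simp only [Finset.mem_filter, Set.Finite.mem_toFinset]; exact ⟨hc, hcb.1⟩)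
    exact absurd hcb.2 (not_lt.2 this)
  set P : Set ℝ := {y | y ∈ Ioo 0 b ∧ ∃ k : ℕ, 1 ≤ k ∧ (σ ^ k) y ∈ C ∧
    ∀ i : ℕ, 0 < i → i < k → (σ ^ i) y ∉ C ∧ (σ ^ i) y ∉ Ioo 0 b} with hP
  -- distinct elements of P lie in distinct cycles
  have hPaux : ∀ y ∈ P, ∀ y' ∈ P, ∀ l : ℕ, (σ ^ l) y = y' → y = y' := by
    rintro y ⟨hy, k, hk, hkC, hkm⟩ y' ⟨hy', k', hk', hkC', -⟩ l hl
    rcases Nat.eq_zero_or_pos l with rfl | hl0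
    · simpa using hl
    · exfalso
      have hkl : k ≤ l := by
        by_contra hc
        refine (hkm l hl0 (by omega)).2 ?_
        rw [hl]; exact hy'
      have h1 := hconv _ hkC (l - k) (l - k + k') (by omega) ?_
      · rw [← Equiv.Perm.mul_apply, ← pow_add, Nat.sub_add_cancel hkl, hl] at h1
        exact hCb _ h1 hy'
      · rw [← Equiv.Perm.mul_apply, ← pow_add, show l - k + k' + k = k' + l by omega, pow_add,
          Equiv.Perm.mul_apply, hl]
        exact hkC'
  have hPcyc : ∀ y ∈ P, ∀ y' ∈ P, σ.SameCycle y y' → y = y' := by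
    rintro y hy y' hy' ⟨k, hk⟩
    rcases Int.eq_nat_or_neg k with ⟨j, rfl | rfl⟩
    · exact hPaux y hy y' hy' j (by simpa using hk)
    · refine (hPaux y' hy' y hy j ?_).symm
      rw [← hk, zpow_neg, zpow_natCast, ← Equiv.Perm.mul_apply, mul_inv_cancel,
        Equiv.Perm.one_apply]
  -- each element of P is in the cycle of 0 or of a discontinuity of σ
  have hDcyc : ∀ y ∈ D, σ.SameCycle y 0 ∨ ∃ x ∈ LD σ, σ.SameCycle y x := by
    intro y hy
    by_contra hcon
    push Not at hcon
    obtain ⟨hc0, hc1⟩ := hcon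
    refine hy.2 (LC_pow n fun i _ => ?_)
    by_contra hc
    have hs : σ.SameCycle y ((σ ^ i) y) := ⟨i, by simp⟩
    have hu := (zpow_mem_unit hmap i y).2 ⟨hy.1.1.le, hy.1.2⟩
    rw [zpow_natCast] at hu
    refine hc1 ((σ ^ i) y) ⟨⟨lt_of_le_of_ne hu.1 (fun h => ?_), hu.2⟩, hc⟩ hs
    rw [← h] at hs
    exact hc0 hs
  have hPB : ∀ y ∈ P, σ.SameCycle y 0 ∨ ∃ x ∈ LD σ, σ.SameCycle y x := by
    rintro y ⟨hy, k, hk, ⟨-, -, z, hz, -, j, -, hj⟩, -⟩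
    have hs : σ.SameCycle y z := by
      refine ⟨((j + k : ℕ) : ℤ), ?_⟩
      rw [zpow_natCast, pow_add, Equiv.Perm.mul_apply, hj]
    rcases hz with rfl | hz | hz
    · exact Or.inl hs
    · exact Or.inr ⟨z, hz, hs⟩
    · rcases hDcyc z hz with h | ⟨x, hx, h⟩
      · exact Or.inl (hs.trans h)
      · exact Or.inr ⟨x, hx, hs.trans h⟩
  have h2D : (2 : ℝ) ∉ D := fun h => by linarith [h.1.2]
  have hfg : ∀ y : ℝ, ∃ f g : ℝ, y ∈ P → f ≠ g ∧ f ∈ D ∧ σ.SameCycle y f ∧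
      ((g ∈ D ∧ σ.SameCycle y g) ∨ (g = 2 ∧ σ.SameCycle y 0)) := by
    intro y
    by_cases hy : y ∈ P
    · by_cases hs : σ.SameCycle y 0
      · refine ⟨(σ ^ (-(n : ℤ))) 0, 2, fun _ => ⟨?_, hT0, hs.trans ⟨_, rfl⟩, Or.inr ⟨rfl, hs⟩⟩⟩
        intro h
        rw [h] at hT0
        exact h2D hT0
      · rcases hPB y hy with h | ⟨x, hx, h⟩
        · exact absurd h hs
        · obtain ⟨f, g, hne, hf, hg, hxf, hxg⟩ := two_discs hmap hfin hap hn hx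
            (fun h' => hs (h.trans h'))
          exact ⟨f, g, fun _ => ⟨hne, hf, h.trans hxf, Or.inl ⟨hg, h.trans hxg⟩⟩⟩
    · exact ⟨0, 0, fun h => absurd h hy⟩
  choose f g hfg using hfg
  have hcross : ∀ y ∈ P, ∀ y' ∈ P, f y ≠ g y' := by
    intro y hy y' hy' he
    obtain ⟨-, hf, hs, -⟩ := hfg y hy
    obtain ⟨hne, -, -, hg⟩ := hfg y' hy'
    rcases hg with ⟨-, hs'⟩ | ⟨h2, -⟩
    · rw [he] at hs
      have := hPcyc y hy y' hy' (hs.trans hs'.symm)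
      subst this
      exact hne he
    · rw [he, h2] at hf
      exact h2D hf
  set Φ : ℝ × Bool → ℝ := fun p => if p.2 then f p.1 else g p.1 with hΦ
  have hΦinj : Set.InjOn Φ (P ×ˢ Set.univ) := by
    rintro ⟨y, s⟩ ⟨hy, -⟩ ⟨y', s'⟩ ⟨hy', -⟩ he
    simp only at hy hy'
    cases s <;> cases s' <;> simp only [hΦ, if_true, Bool.false_eq_true, if_false] at he
    · have : y = y' := by
        obtain ⟨-, -, -, hg⟩ := hfg y hy
        obtain ⟨-, -, -, hg'⟩ := hfg y' hy'
        rcases hg with ⟨h1, h2⟩ | ⟨h1, h2⟩ <;> rcases hg' with ⟨h3, h4⟩ | ⟨h3, h4⟩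
        · rw [he] at h2
          exact hPcyc y hy y' hy' (h2.trans h4.symm)
        · rw [he, h3] at h1; exact absurd h1 h2D
        · rw [← he, h1] at h3; exact absurd h3 h2D
        · exact hPcyc y hy y' hy' (h2.trans h4.symm)
      rw [this]
    · exact absurd he.symm (hcross y' hy' y hy)
    · exact absurd he (hcross y hy y' hy')
    · obtain ⟨-, -, h1, -⟩ := hfg y hy
      obtain ⟨-, -, h2, -⟩ := hfg y' hy'
      rw [he] at h1
      rw [hPcyc y hy y' hy' (h1.trans h2.symm)]
  have hΦmaps : Set.MapsTo Φ (P ×ˢ Set.univ) (insert 2 D) := by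
    rintro ⟨y, s⟩ ⟨hy, -⟩
    simp only at hy
    obtain ⟨-, h1, -, h2⟩ := hfg y hy
    cases s <;> simp only [hΦ, if_true, Bool.false_eq_true, if_false]
    · rcases h2 with h2 | h2
      · exact Or.inr h2.1
      · exact Or.inl h2.1
    · exact Or.inr h1
  have hfinI : (insert 2 D).Finite := hfinT.insert 2
  have hPPfin : (P ×ˢ (Set.univ : Set Bool)).Finite := Set.Finite.of_injOn hΦmaps hΦinj hfinI
  have hPfin : P.Finite := by
    have := hPPfin.image Prod.fst
    refine this.subset fun y hy => ⟨(y, true), ⟨hy, Set.mem_univ _⟩, rfl⟩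
  have hcard : 2 * hPfin.toFinset.card ≤ D.ncard + 1 := by
    have h1 := Set.ncard_le_ncard_of_injOn Φ hΦmaps hΦinj hfinI
    rw [Set.ncard_insert_of_notMem h2D hfinT, Set.ncard_prod, Set.ncard_univ,
      Set.ncard_eq_toFinset_card P hPfin] at h1
    simp at h1
    omega
  have td : TD σ C b hPfin.toFinset :=
    { hmap := hmap
      hR := hR
      hb := hbm.1
      hb0 := hbm.2
      hb1 := hb1
      hCb := hCb
      hLC := by
        intro x hx hxC
        by_contra hc
        exact hxC (hBC (Or.inr (Or.inl ⟨hx, hc⟩)))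
      hP := by
        intro y
        simp [hP]
      hdense := hdense b hbm.2 hb1 }
  refine ⟨insert b hPfin.toFinset, ?_, ?_⟩
  · have := Finset.card_insert_le b hPfin.toFinset
    omega
  · intro c hc
    apply td.main
    rcases hc with hc | hc
    · have := hBC (Or.inr (Or.inr hc))
      exact Or.inl ⟨this, hCu _ this⟩
    · exact Or.inr hc

end

lemma cont_of_LC_RC {F : ℝ → ℝ} {x : ℝ} (hR : RC F x) (hL : x = 0 ∨ LC F x) :
    ContinuousWithinAt F unitI x := by
  obtain ⟨ε, he, h⟩ := ev_iff.1 hR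
  have hright : ∀ y, x ≤ y → y < x + ε → F y = y + (F x - x) := by
    intro y h1 h2
    rcases h1.eq_or_lt with rfl | h1
    · ring
    · have := h (y - x) (by linarith) (by linarith)
      rw [add_sub_cancel] at this
      linarith
  have hc : ContinuousWithinAt (fun y : ℝ => y + (F x - x)) unitI x :=
    (continuous_id.add continuous_const).continuousWithinAt
  refine hc.congr_of_eventuallyEq ?_ (by ring)
  rcases hL with rfl | hL
  · filter_upwards [self_mem_nhdsWithin,
      mem_nhdsWithin_of_mem_nhds (Iio_mem_nhds (show (0 : ℝ) < 0 + ε by linarith))] with y hy hy2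
    exact hright y hy.1 hy2
  · obtain ⟨ε', he', h'⟩ := ev_iff.1 hL
    filter_upwards [mem_nhdsWithin_of_mem_nhds (Ioo_mem_nhds (show x - ε' < x by linarith)
      (show x < x + ε by linarith))] with y hy
    rcases le_or_gt x y with h1 | h1
    · exact hright y h1 hy.2
    · have := h' (x - y) (by linarith) (by linarith [hy.1])
      rw [sub_sub_cancel] at this
      linarith

lemma RC_pow {σ : Equiv.Perm ℝ} (hmap : ∀ x, σ x ∈ unitI ↔ x ∈ unitI)
    (hR : ∀ x ∈ unitI, RC σ x) {x : ℝ} (hx : x ∈ unitI) (k : ℕ) :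
    RC (σ ^ k : Equiv.Perm ℝ) x := by
  induction k with
  | zero => simp [RC]
  | succ k ih =>
    have h1 := (zpow_mem_unit hmap k x).2 hx
    rw [zpow_natCast] at h1
    have h2 := hR _ h1
    unfold RC at *
    filter_upwards [ih, h2] with δ a b
    simp only [pow_succ', Equiv.Perm.mul_apply]
    rw [a, b]

lemma betaPt_succ {m : ℕ} (lam : Fin m → ℝ) (j : Fin m) :
    betaPt lam ((j : ℕ) + 1) = betaPt lam j + lam j := by
  classical
  unfold betaPt
  have : Finset.univ.filter (fun i : Fin m => (i : ℕ) < (j : ℕ) + 1) =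
      insert j (Finset.univ.filter (fun i : Fin m => (i : ℕ) < (j : ℕ))) := by
    ext i
    simp [Fin.ext_iff]
    omega
  rw [this, Finset.sum_insert (by simp), add_comm]

lemma betaPt_mono {m : ℕ} (lam : Fin m → ℝ) (hpos : ∀ i, 0 < lam i) {j k : ℕ} (h : j ≤ k) :
    betaPt lam j ≤ betaPt lam k := by
  unfold betaPt
  apply Finset.sum_le_sum_of_subset_of_nonneg
  · intro i hi
    simp only [Finset.mem_filter] at hi ⊢
    exact ⟨hi.1, by omega⟩
  · intro i _ _
    exact (hpos i).le

lemma piece_unique {m : ℕ} (lam : Fin m → ℝ) (hpos : ∀ i, 0 < lam i) {j k : Fin m} {x : ℝ}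
    (hj : x ∈ Ico (betaPt lam j) (betaPt lam j + lam j))
    (hk : x ∈ Ico (betaPt lam k) (betaPt lam k + lam k)) : j = k := by
  rw [← betaPt_succ] at hj hk
  rcases lt_trichotomy (j : ℕ) (k : ℕ) with h | h | h
  · have := betaPt_mono lam hpos (show (j : ℕ) + 1 ≤ k from h)
    linarith [hj.2, hk.1]
  · exact Fin.ext h
  · have := betaPt_mono lam hpos (show (k : ℕ) + 1 ≤ j from h)
    linarith [hk.2, hj.1]

lemma ietMap_piece {m : ℕ} (π : Equiv.Perm (Fin m)) (lam : Fin m → ℝ) (hpos : ∀ i, 0 < lam i)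
    (j : Fin m) : ∃ c : ℝ, ∀ x ∈ Ico (betaPt lam j) (betaPt lam j + lam j),
      ietMap π lam x = x + c := by
  refine ⟨- betaPt lam j + ∑ i ∈ Finset.univ.filter (fun i : Fin m => π i < π j), lam i, ?_⟩
  intro x hx
  have h : ∃ j : Fin m, x ∈ Set.Ico (betaPt lam (j : ℕ)) (betaPt lam (j : ℕ) + lam j) := ⟨j, hx⟩
  have hj : h.choose = j := piece_unique lam hpos h.choose_spec hx
  unfold ietMap
  rw [dif_pos h, hj]
  ring

lemma LD_ietMap {m : ℕ} (π : Equiv.Perm (Fin m)) (lam : Fin m → ℝ) (hpos : ∀ i, 0 < lam i)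
    (hsum : ∑ i, lam i = 1) :
    LD (ietMap π lam) ⊆ ((Finset.Ico 1 m).image (betaPt lam) : Finset ℝ) := by
  rintro x ⟨hx, hxL⟩
  have hex : ∃ j : Fin m, x ∈ Ico (betaPt lam j) (betaPt lam j + lam j) := by
    by_contra hcon
    push Not at hcon
    have hle : ∀ j : ℕ, j ≤ m → betaPt lam j ≤ x := by
      intro j
      induction j with
      | zero => intro _; simpa [betaPt] using hx.1.le
      | succ j ih =>
        intro hj
        by_contra hc
        refine hcon ⟨j, by omega⟩ ⟨ih (by omega), ?_⟩
        rw [← betaPt_succ]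
        exact not_le.1 hc
    have h1 := hle m le_rfl
    have h2 : betaPt lam m = 1 := by simp [betaPt, hsum]
    linarith [hx.2]
  obtain ⟨j, hj⟩ := hex
  obtain ⟨c, hc⟩ := ietMap_piece π lam hpos j
  by_cases he : betaPt lam j = x
  · simp only [Finset.coe_image, Set.mem_image, Finset.coe_Ico]
    refine ⟨j, ⟨?_, j.2⟩, he⟩
    by_contra hj0
    have : (j : ℕ) = 0 := by omega
    rw [this] at he
    simp [betaPt] at he
    linarith [hx.1]
  · exfalso
    have hlt := lt_of_le_of_ne hj.1 he
    refine hxL (ev_iff.2 ⟨x - betaPt lam j, by linarith, fun δ hd hd' => ?_⟩)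
    rw [hc x hj, hc (x - δ) ⟨by linarith, by linarith [hj.2]⟩]
    ring

/-- a minimal m-IET with separating permutation admitting an n-th root
(n ≥ 2) has rank at most 1 + ⌊m/2⌋. -/
theorem stmt1 {m : ℕ} (π : Equiv.Perm (Fin m)) (lam : Fin m → ℝ)
    (hpos : ∀ i, 0 < lam i) (hsum : ∑ i, lam i = 1)
    (hsep : Separating π)
    (hmin : IsMinimal (ietMap π lam))
    (S : ℝ → ℝ) (n : ℕ) (hS : IsIET S) (hn : 2 ≤ n)
    (hroot : S^[n] = ietMap π lam) :
    ietRank (ietMap π lam) ≤ 1 + m / 2 := by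
  classical
  obtain ⟨σ, hσ⟩ := hS.exists_perm
  have hσS : (σ : ℝ → ℝ) = S := funext hσ
  have hT : ((σ ^ n : Equiv.Perm ℝ) : ℝ → ℝ) = ietMap π lam := by
    rw [← hroot, ← hσS, Equiv.Perm.iterate_eq_pow]
  have hmap : ∀ x, σ x ∈ unitI ↔ x ∈ unitI := by
    intro x
    rw [hσ]
    constructor
    · intro h
      by_contra hx
      rw [hS.2.1 x hx] at h
      exact hx h
    · intro h
      exact hS.1.mapsTo h
  have hR : ∀ x ∈ unitI, RC σ x := by
    intro x hx
    rw [hσS]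
    exact hS.RC hx
  have hfin : (LD σ).Finite := by
    rw [hσS]
    exact hS.LD_finite
  have horb : ∀ x y, y ∈ orbitZ (ietMap π lam) x → ∃ k : ℤ, (σ ^ k) x = y := by
    rintro x y ⟨k, h | h⟩
    · rw [← hT, Equiv.Perm.iterate_eq_pow, ← pow_mul] at h
      exact ⟨((n * k : ℕ) : ℤ), by rw [zpow_natCast, h]⟩
    · rw [← hT, Equiv.Perm.iterate_eq_pow, ← pow_mul] at h
      refine ⟨-((n * k : ℕ) : ℤ), ?_⟩
      rw [zpow_neg, zpow_natCast, ← h, ← Equiv.Perm.mul_apply, inv_mul_cancel,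
        Equiv.Perm.one_apply]
  have hap : ∀ x ∈ unitI, ∀ k : ℤ, (σ ^ k) x = x → k = 0 := by
    intro x hx k hk
    by_contra hk0
    have hfo : (orbitZ (ietMap π lam) x).Finite := by
      refine ((Set.finite_Ico (0 : ℤ) |k|).image (fun i => (σ ^ i) x)).subset ?_
      intro y hy
      obtain ⟨i, rfl⟩ := horb x y hy
      refine ⟨i % k, ⟨Int.emod_nonneg _ hk0, Int.emod_lt_abs _ hk0⟩, ?_⟩
      simp only
      conv_rhs => rw [← Int.emod_add_mul_ediv i k, zpow_add, Equiv.Perm.mul_apply, zpow_mul,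
        Equiv.Perm.zpow_apply_eq_self_of_apply_eq_self hk]
    have h1 := hmin x hx
    rw [hfo.isClosed.closure_eq] at h1
    exact Set.Ico_infinite (zero_lt_one' ℝ) (hfo.subset h1)
  have hdense : ∀ b : ℝ, 0 < b → b < 1 → ∀ x ∈ unitI, ∃ k : ℤ, (σ ^ k) x ∈ Ioo 0 b := by
    intro b hb0 hb1 x hx
    have h1 := hmin x hx (show b / 2 ∈ unitI from ⟨by linarith, by linarith⟩)
    obtain ⟨y, hy, hyo⟩ := mem_closure_iff.1 h1 (Ioo 0 b) isOpen_Ioo ⟨by linarith, by linarith⟩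
    obtain ⟨k, hk⟩ := horb x y hyo
    exact ⟨k, hk ▸ hy⟩
  have hLDsub := LD_ietMap π lam hpos hsum
  rw [← hT] at hLDsub
  have hfinT : (LD (σ ^ n : Equiv.Perm ℝ)).Finite := (Finset.finite_toSet _).subset hLDsub
  obtain ⟨Q, hQ, hQspan⟩ := count hmap hR hfin hap hdense hn hfinT
  have hcard : (LD (σ ^ n : Equiv.Perm ℝ)).ncard ≤ m - 1 := by
    refine (Set.ncard_le_ncard hLDsub (Finset.finite_toSet _)).trans ?_
    rw [Set.ncard_coe_finset]
    refine Finset.card_image_le.trans ?_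
    simp
  have hm : 0 < m := by
    rcases Nat.eq_zero_or_pos m with rfl | h
    · simp at hsum
    · exact h
  have hend : ∀ c ∈ endpointsOf (ietMap π lam), c ∈ Submodule.span ℚ (Q : Set ℝ) := by
    rintro c (rfl | rfl | ⟨hc, hcd⟩)
    · exact Submodule.zero_mem _
    · exact hQspan 1 (Or.inr rfl)
    · refine hQspan c (Or.inl ?_)
      rw [← hT] at hcd
      have hrc := RC_pow hmap hR hc n
      refine ⟨⟨lt_of_le_of_ne hc.1 (fun h => hcd (cont_of_LC_RC hrc (Or.inl h.symm))), hc.2⟩, ?_⟩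
      exact fun h => hcd (cont_of_LC_RC hrc (Or.inr h))
  have hle : Submodule.span ℚ (gapLengths (ietMap π lam)) ≤ Submodule.span ℚ (Q : Set ℝ) := by
    rw [Submodule.span_le]
    rintro l ⟨a, ha, b, hb, -, -, rfl⟩
    exact Submodule.sub_mem _ (hend b hb) (hend a ha)
  have hfr : Module.finrank ℚ (Submodule.span ℚ (gapLengths (ietMap π lam))) ≤ Q.card :=
    (Submodule.finrank_mono hle).trans (finrank_span_finset_le_card Q)
  unfold ietRank
  omega

end IETRoots
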